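/- Any Boolean function in the Reed–Muller code RM(r,v) of minimum nonzero weight 2^{v−r} is the characteristic function of a (v−r)-dimensional affine subspace of F_2^v. -/

import Mathlib

/-- The Reed–Muller code `RM(r,v)`: Boolean functions representable by a
polynomial over `F_2` of total degree at most `r`. -/
def RM (r v : ℕ) (f : (Fin v → ZMod 2) → ZMod 2) : Prop :=
  ∃ P : MvPolynomial (Fin v) (ZMod 2),
    P.totalDegree ≤ r ∧ ∀ x, MvPolynomial.eval x P = f x

/-- The weight of a Boolean function: its number of ones. -/
def weight {v : ℕ} (f : (Fin v → ZMod 2) → ZMod 2) : ℕ :=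
  (Finset.univ.filter (fun x => f x = 1)).card

/-- Degree at most `r` via iterated derivatives. -/
def DegLE {v : ℕ} : ℕ → ((Fin v → ZMod 2) → ZMod 2) → Prop
  | 0, f => ∀ x y, f x = f y
  | r + 1, f => ∀ h, DegLE r (fun x => f (x + h) + f x)

theorem z2 (a : ZMod 2) : a = 0 ∨ a = 1 := by
  revert a; decide

theorem z2_add (a : ZMod 2) : a + a = 0 := by
  revert a; decide

theorem DegLE.zero {v : ℕ} (r : ℕ) : DegLE (v := v) r (fun _ => 0) := by
  induction r with
  | zero => intro x y; rfl
  | succ r ih => intro h; simpa using ih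

theorem DegLE.mono {v : ℕ} (r : ℕ) : ∀ f : (Fin v → ZMod 2) → ZMod 2,
    DegLE r f → DegLE (r + 1) f := by
  induction r with
  | zero =>
    intro f hf h x y
    simp only [DegLE] at hf
    simp only [hf (x + h) x, hf (y + h) y, z2_add]
  | succ r ih => intro f hf h; exact ih _ (hf h)

theorem DegLE.mono' {v : ℕ} {r s : ℕ} (h : r ≤ s) {f : (Fin v → ZMod 2) → ZMod 2}
    (hf : DegLE r f) : DegLE s f := by
  induction h with
  | refl => exact hf
  | step _ ih => exact DegLE.mono _ _ ih

theorem DegLE.add {v : ℕ} (r : ℕ) : ∀ f g : (Fin v → ZMod 2) → ZMod 2,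
    DegLE r f → DegLE r g → DegLE r (fun x => f x + g x) := by
  induction r with
  | zero =>
    intro f g hf hg x y
    simp only [hf x y, hg x y]
  | succ r ih =>
    intro f g hf hg h
    have := ih _ _ (hf h) (hg h)
    convert this using 2
    ring

theorem DegLE.const_mul {v : ℕ} (r : ℕ) (c : ZMod 2) (f : (Fin v → ZMod 2) → ZMod 2)
    (hf : DegLE r f) : DegLE r (fun x => c * f x) := by
  rcases z2 c with rfl | rfl
  · simpa using DegLE.zero r
  · simpa using hf

theorem DegLE.X_mul {v : ℕ} (i : Fin v) (r : ℕ) : ∀ f : (Fin v → ZMod 2) → ZMod 2,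
    DegLE r f → DegLE (r + 1) (fun x => x i * f x) := by
  induction r with
  | zero =>
    intro f hf h x y
    simp only [DegLE] at hf
    simp only [hf (x + h) 0, hf (y + h) 0, hf x 0, hf y 0, Pi.add_apply]
    linear_combination f 0 * (z2_add (x i)) - f 0 * (z2_add (y i))
  | succ r ih =>
    intro f hf h
    have h1 := ih _ (hf h)
    have h2 := DegLE.const_mul _ (h i) _ (DegLE.add _ _ _ hf (DegLE.mono _ _ (hf h)))
    have h3 := DegLE.add _ _ _ h1 h2
    convert h3 using 2 with x
    simp only [Pi.add_apply]
    linear_combination - h i * (z2_add (f x))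

theorem DegLE.monomial {v : ℕ} (s : Fin v →₀ ℕ) : ∀ (r : ℕ) (g : (Fin v → ZMod 2) → ZMod 2),
    DegLE r g → DegLE (r + s.sum fun _ e => e) (fun x => (s.prod fun i e => x i ^ e) * g x) := by
  induction s using Finsupp.induction_linear with
  | zero => intro r g hg; simpa using hg
  | add s t hs ht =>
    intro r g hg
    have := hs _ _ (ht r g hg)
    rw [Finsupp.sum_add_index' (by simp) (by simp)]
    convert this using 1
    · ring
    · funext x
      rw [Finsupp.prod_add_index' (by simp) (by intros; rw [pow_add])]
      ring
  | single i n =>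
    intro r g hg
    simp only [Finsupp.sum_single_index, Finsupp.prod_single_index, pow_zero]
    induction n with
    | zero => simpa using hg
    | succ n ih =>
      have := DegLE.X_mul i _ _ ih
      convert this using 1
      · rfl
      · funext x
        ring

theorem DegLE.sum {v : ℕ} {ι : Type*} (r : ℕ) (s : Finset ι)
    (f : ι → (Fin v → ZMod 2) → ZMod 2) (hf : ∀ i ∈ s, DegLE r (f i)) :
    DegLE r (fun x => ∑ i ∈ s, f i x) := by
  classical
  induction s using Finset.induction_on with
  | empty => simpa using DegLE.zero r
  | insert a s ha ih =>
    simp only [Finset.sum_insert ha]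
    exact DegLE.add _ _ _ (hf a (by simp)) (ih fun i hi => hf i (by simp [hi]))

theorem DegLE.of_RM {v r : ℕ} (f : (Fin v → ZMod 2) → ZMod 2) (hf : RM r v f) :
    DegLE r f := by
  obtain ⟨P, hP, hf⟩ := hf
  have : f = fun x => ∑ d ∈ P.support, P.coeff d * (d.prod fun i e => x i ^ e) := by
    funext x
    rw [← hf x, MvPolynomial.eval_eq]
    rfl
  rw [this]
  refine DegLE.sum r _ _ fun d hd => DegLE.const_mul _ _ _ ?_
  have h1 : DegLE (v := v) 0 (fun _ => 1) := fun _ _ => rfl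
  have := DegLE.monomial d 0 _ h1
  simp only [mul_one, zero_add] at this
  exact DegLE.mono' ((MvPolynomial.le_totalDegree hd).trans hP) this

theorem weight_deriv {v : ℕ} (f : (Fin v → ZMod 2) → ZMod 2) (h : Fin v → ZMod 2) :
    weight (fun x => f (x + h) + f x) +
      (Finset.univ.filter (fun x => f x = 1 ∧ f (x + h) = 1)).card ≤ 2 * weight f := by
  classical
  have hB : (Finset.univ.filter (fun x => f (x + h) = 1)).card = weight f := by
    unfold weight
    refine Finset.card_bij (fun x _ => x + h) (by simp) (by simp) ?_
    intro b hb
    refine ⟨b - h, by simpa using hb, by simp⟩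
  have hle := Finset.card_union_le (Finset.univ.filter (fun x => f x = 1))
    (Finset.univ.filter (fun x => f (x + h) = 1))
  rw [hB] at hle
  have : weight (fun x => f (x + h) + f x) +
      (Finset.univ.filter (fun x => f x = 1 ∧ f (x + h) = 1)).card ≤
      (Finset.univ.filter (fun x => f x = 1) ∪ Finset.univ.filter (fun x => f (x + h) = 1)).card := by
    unfold weight
    rw [← Finset.card_union_of_disjoint]
    · apply Finset.card_le_card
      intro x
      simp only [Finset.mem_union, Finset.mem_filter, Finset.mem_univ, true_and]
      rcases z2 (f x) with h1 | h1 <;> rcases z2 (f (x + h)) with h2 | h2 <;> simp [h1, h2]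
    · rw [Finset.disjoint_left]
      intro x
      simp only [Finset.mem_filter, Finset.mem_univ, true_and]
      rintro h1 ⟨h2, h3⟩
      rw [h2, h3] at h1
      revert h1; decide
  unfold weight at *
  omega

theorem weight_bound {v : ℕ} (r : ℕ) : ∀ f : (Fin v → ZMod 2) → ZMod 2, DegLE r f →
    (∃ x, f x = 1) → 2 ^ v ≤ 2 ^ r * weight f := by
  have hconst : ∀ f : (Fin v → ZMod 2) → ZMod 2, (∀ x, f x = 1) → weight f = 2 ^ v := by
    intro f hf
    simp [weight, hf]
  induction r with
  | zero =>
    rintro f hf ⟨x, hx⟩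
    rw [hconst f fun y => (hf y x).trans hx]
    simp
  | succ r ih =>
    rintro f hf ⟨x, hx⟩
    by_cases hd : ∃ h y, f (y + h) + f y = 1
    · obtain ⟨h, hy⟩ := hd
      have h1 := ih _ (hf h) hy
      have h2 := weight_deriv f h
      calc 2 ^ v ≤ _ := h1
        _ ≤ 2 ^ r * (2 * weight f) := Nat.mul_le_mul_left _ (by omega)
        _ = _ := by ring
    · push Not at hd
      rw [hconst f]
      · exact Nat.le_mul_of_pos_left _ (by positivity)
      · intro y
        have h0 := hd (y - x) x
        rw [add_sub_cancel, hx] at h0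
        rcases z2 (f y) with h | h
        · simp [h] at h0
        · exact h

theorem closed_of_min {v r : ℕ} (f : (Fin v → ZMod 2) → ZMod 2) (hf : DegLE r f)
    (hw : weight f * 2 ^ r = 2 ^ v) (x y z : Fin v → ZMod 2)
    (hx : f x = 1) (hy : f y = 1) (hz : f z = 1) : f (z + (y - x)) = 1 := by
  cases r with
  | zero => exact (hf _ z).trans hz
  | succ r =>
    by_contra hne
    have h0 := (z2 (f (z + (y - x)))).resolve_right hne
    have h1 := weight_bound r _ (hf (y - x)) ⟨z, by rw [h0, hz]; rfl⟩
    have h2 := weight_deriv f (y - x)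
    have h3 : 0 < (Finset.univ.filter (fun u => f u = 1 ∧ f (u + (y - x)) = 1)).card :=
      Finset.card_pos.2 ⟨x, by simp [hx, hy]⟩
    have h4 : 2 ^ r * weight (fun u => f (u + (y - x)) + f u) < 2 ^ r * (2 * weight f) :=
      Nat.mul_lt_mul_of_pos_left (by omega) (by positivity)
    have h5 : 2 ^ r * (2 * weight f) = weight f * 2 ^ (r + 1) := by ring
    omega

/-- a codeword of `RM(r,v)` of minimum nonzero weight `2^(v-r)` is the
characteristic function of a `(v-r)`-dimensional affine subspace of `F_2^v`. -/
theorem RM_min_weight_affine (v r : ℕ)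
    (f : (Fin v → ZMod 2) → ZMod 2) (hf : RM r v f)
    (hw : weight f = 2 ^ (v - r)) :
    ∃ (W : Submodule (ZMod 2) (Fin v → ZMod 2)) (a : Fin v → ZMod 2),
      Module.finrank (ZMod 2) W = v - r ∧
      ∀ x, f x = 1 ↔ x ∈ (fun y => a + y) '' (W : Set (Fin v → ZMod 2)) := by
  have hcl : ∀ x y z, f x = 1 → f y = 1 → f z = 1 → f (z + (y - x)) = 1 := by
    intro x y z hx hy hz
    by_cases hr : r ≤ v
    · refine closed_of_min f (DegLE.of_RM f hf) ?_ x y z hx hy hz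
      rw [hw, ← pow_add, Nat.sub_add_cancel hr]
    · rw [Nat.sub_eq_zero_of_le (by omega), pow_zero] at hw
      have := Finset.card_le_one.1 hw.le x (by simp [hx]) y (by simp [hy])
      rw [this]; simpa using hz
  have hpos : 0 < weight f := by rw [hw]; positivity
  obtain ⟨a, ha⟩ := Finset.card_pos.1 hpos
  have ha : f a = 1 := by simpa using ha
  let W : Submodule (ZMod 2) (Fin v → ZMod 2) :=
    { carrier := {w | f (a + w) = 1}
      zero_mem' := by simpa using ha
      add_mem' := by
        intro x y hx hy
        have := hcl a (a + y) (a + x) ha hy hx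
        simpa [add_assoc] using this
      smul_mem' := by
        intro c x hx
        rcases z2 c with rfl | rfl
        · simpa using ha
        · simpa using hx }
  have hW : ∀ w, w ∈ W ↔ f (a + w) = 1 := fun w => Iff.rfl
  refine ⟨W, a, ?_, ?_⟩
  · have h1 : Nat.card W = weight f := by
      classical
      have : Nat.card W = (Finset.univ.filter (fun w => f (a + w) = 1)).card := by
        rw [← Fintype.card_subtype, ← Nat.card_eq_fintype_card]
        rfl
      rw [this]
      refine Finset.card_bij (fun x _ => a + x) (by simp) (by simp) ?_
      intro b hb
      exact ⟨b - a, by simpa using hb, by simp⟩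
    have h2 := Module.natCard_eq_pow_finrank (K := ZMod 2) (V := W)
    rw [h1, hw, Nat.card_zmod] at h2
    exact (Nat.pow_right_injective le_rfl h2).symm
  · intro x
    constructor
    · intro hx
      exact ⟨x - a, by simpa [hW] using hx, by simp⟩
    · rintro ⟨y, hy, rfl⟩
      exact hy
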